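/- Structural theorem for sketched least squares (objective value): under Conditions I and II, any minimizer of the sketched problem is a relative-error approximation on the objective: ‖A *ᵥ x̃_opt − b‖ ≤ (1 + ε)·Z. -/

import Mathlib

open Matrix

/-- Euclidean norm of a vector. -/
noncomputable def vecNorm {m : ℕ} (v : Fin m → ℝ) : ℝ :=
  Real.sqrt (∑ i, (v i) ^ 2)

theorem vecNorm_sq {m : ℕ} (v : Fin m → ℝ) : vecNorm v ^ 2 = v ⬝ᵥ v := by
  rw [vecNorm, Real.sq_sqrt (Finset.sum_nonneg fun i _ => sq_nonneg _)]
  simp [dotProduct, sq]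

theorem vecNorm_nonneg {m : ℕ} (v : Fin m → ℝ) : 0 ≤ vecNorm v :=
  Real.sqrt_nonneg _

theorem dotProduct_self_le_of_vecNorm_le {m k : ℕ} {u : Fin m → ℝ} {v : Fin k → ℝ}
    (h : vecNorm u ≤ vecNorm v) : u ⬝ᵥ u ≤ v ⬝ᵥ v := by
  rw [← vecNorm_sq, ← vecNorm_sq]
  exact pow_le_pow_left₀ (vecNorm_nonneg u) h 2

/-- A vector that is shortest on the line through it in direction `q` is orthogonal to `q`. -/
theorem dotProduct_eq_zero_of_forall_vecNorm_le {m : ℕ} {p q : Fin m → ℝ}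
    (h : ∀ t : ℝ, vecNorm p ≤ vecNorm (p + t • q)) : p ⬝ᵥ q = 0 := by
  have hquad : ∀ t : ℝ, 0 ≤ (q ⬝ᵥ q) * (t * t) + (2 * (p ⬝ᵥ q)) * t + 0 := by
    intro t
    have ht := dotProduct_self_le_of_vecNorm_le (h t)
    simp only [add_dotProduct, dotProduct_add, smul_dotProduct, dotProduct_smul, smul_eq_mul,
      dotProduct_comm q p] at ht
    linarith
  have hdiscrim := discrim_le_zero hquad
  rw [discrim] at hdiscrim
  nlinarith

/-- A full-rank matrix `A = U Uᵀ A` has `Uᵀ A` surjective. -/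
theorem mulVec_surjective_of_rank_eq {n d : ℕ} {A U : Matrix (Fin n) (Fin d) ℝ}
    (hrank : A.rank = d) (hUA : U * Uᵀ * A = A) :
    Function.Surjective (Uᵀ * A).mulVec := by
  have hle : d ≤ (Uᵀ * A).rank := by
    calc d = (U * (Uᵀ * A)).rank := by rw [← Matrix.mul_assoc, hUA, hrank]
      _ ≤ (Uᵀ * A).rank := Matrix.rank_mul_le_right _ _
  have htop : LinearMap.range (Uᵀ * A).mulVecLin = ⊤ := by
    apply Submodule.eq_top_of_finrank_eq
    have hge := (Uᵀ * A).rank_le_width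
    rw [Module.finrank_fin_fun]
    exact le_antisymm hge hle
  exact LinearMap.range_eq_top.mp htop

/-- Pythagoras for a sum of a vector in the column space of `U` and one orthogonal to it. -/
theorem dotProduct_self_mulVec_sub {n d : ℕ} {U : Matrix (Fin n) (Fin d) ℝ} (hU : Uᵀ * U = 1)
    {v : Fin n → ℝ} (hv : Uᵀ *ᵥ v = 0) (w : Fin d → ℝ) :
    (U *ᵥ w - v) ⬝ᵥ (U *ᵥ w - v) = w ⬝ᵥ w + v ⬝ᵥ v := by
  have hww : (U *ᵥ w) ⬝ᵥ (U *ᵥ w) = w ⬝ᵥ w := by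
    rw [dotProduct_mulVec, ← mulVec_transpose, mulVec_mulVec, hU, one_mulVec]
  have hvw : v ⬝ᵥ (U *ᵥ w) = 0 := by
    rw [dotProduct_mulVec, ← mulVec_transpose, hv, zero_dotProduct]
  simp only [sub_dotProduct, dotProduct_sub, dotProduct_comm (U *ᵥ w) v, hww, hvw]
  ring

/-- If `‖B w‖² ≥ ‖w‖² / 2` and the residual `B w - v` is orthogonal to `B w`, then
`‖w‖² ≤ 4 ‖Bᵀ v‖²`. -/
theorem dotProduct_self_le_of_residual_orthogonal {r d : ℕ} {B : Matrix (Fin r) (Fin d) ℝ}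
    {v : Fin r → ℝ} {w : Fin d → ℝ} (hB : w ⬝ᵥ w / 2 ≤ (B *ᵥ w) ⬝ᵥ (B *ᵥ w))
    (horth : (B *ᵥ w - v) ⬝ᵥ (B *ᵥ w) = 0) :
    w ⬝ᵥ w ≤ 4 * ((Bᵀ *ᵥ v) ⬝ᵥ (Bᵀ *ᵥ v)) := by
  have hinner : (B *ᵥ w) ⬝ᵥ (B *ᵥ w) = w ⬝ᵥ (Bᵀ *ᵥ v) := by
    rw [sub_dotProduct, sub_eq_zero] at horth
    rw [horth, dotProduct_mulVec, ← mulVec_transpose, dotProduct_comm]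
  have hnonneg : 0 ≤ (w - (2 : ℝ) • (Bᵀ *ᵥ v)) ⬝ᵥ (w - (2 : ℝ) • (Bᵀ *ᵥ v)) := by
    rw [← vecNorm_sq]
    exact sq_nonneg _
  simp only [sub_dotProduct, dotProduct_sub, smul_dotProduct, dotProduct_smul, smul_eq_mul,
    dotProduct_comm (Bᵀ *ᵥ v) w] at hnonneg
  linarith

theorem stmt_13 {n d r : ℕ} (hn : 0 < n) (hd : 0 < d) (hr : 0 < r)
    (A : Matrix (Fin n) (Fin d) ℝ) (hrank : A.rank = d)
    (b : Fin n → ℝ)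
    (U : Matrix (Fin n) (Fin d) ℝ) (hU : Uᵀ * U = 1) (hUA : U * Uᵀ * A = A)
    (xopt : Fin d → ℝ)
    (hxopt : ∀ x : Fin d → ℝ, vecNorm (A *ᵥ xopt - b) ≤ vecNorm (A *ᵥ x - b))
    (Z : ℝ) (hZ : Z = vecNorm (A *ᵥ xopt - b))
    (bperp : Fin n → ℝ) (hbperp : bperp = b - U *ᵥ (Uᵀ *ᵥ b))
    (ε : ℝ) (hε : ε ∈ Set.Ioo (0 : ℝ) 1)
    (X : Matrix (Fin r) (Fin n) ℝ)
    (hcond1 : ∀ y : Fin d → ℝ, vecNorm ((X * U) *ᵥ y) ≥ (1 / Real.sqrt 2) * vecNorm y)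
    (hcond2 : vecNorm ((X * U)ᵀ *ᵥ (X *ᵥ bperp)) ^ 2 ≤ (ε / 2) * Z ^ 2)
    (xtilde : Fin d → ℝ)
    (hxtilde : ∀ x : Fin d → ℝ,
      vecNorm (X *ᵥ (A *ᵥ xtilde - b)) ≤ vecNorm (X *ᵥ (A *ᵥ x - b))) :
    vecNorm (A *ᵥ xtilde - b) ≤ (1 + ε) * Z := by
  have hsurj := mulVec_surjective_of_rank_eq hrank hUA
  have hperp : Uᵀ *ᵥ bperp = 0 := by
    rw [hbperp, mulVec_sub, mulVec_mulVec, hU, one_mulVec, sub_self]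
  have hA : ∀ x, A *ᵥ x = U *ᵥ ((Uᵀ * A) *ᵥ x) := by
    intro x
    rw [mulVec_mulVec, ← Matrix.mul_assoc, hUA]
  have hres : ∀ x, A *ᵥ x - b = U *ᵥ ((Uᵀ * A) *ᵥ x - Uᵀ *ᵥ b) - bperp := by
    intro x
    rw [hbperp, mulVec_sub, ← hA]
    abel
  have hpyth : ∀ x, vecNorm (A *ᵥ x - b) ^ 2 =
      ((Uᵀ * A) *ᵥ x - Uᵀ *ᵥ b) ⬝ᵥ ((Uᵀ * A) *ᵥ x - Uᵀ *ᵥ b) + bperp ⬝ᵥ bperp := by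
    intro x
    rw [vecNorm_sq, hres, dotProduct_self_mulVec_sub hU hperp]
  have hZperp : bperp ⬝ᵥ bperp ≤ Z ^ 2 := by
    rw [hZ, hpyth, ← vecNorm_sq (_ - _)]
    exact le_add_of_nonneg_left (sq_nonneg _)
  have hZ0 : 0 ≤ Z := hZ ▸ vecNorm_nonneg _
  have hp := hpyth xtilde
  have hr' := hres xtilde
  set w := (Uᵀ * A) *ᵥ xtilde - Uᵀ *ᵥ b with hw
  obtain ⟨y, hy⟩ := hsurj w
  have hXp : X *ᵥ (A *ᵥ xtilde - b) = (X * U) *ᵥ w - X *ᵥ bperp := by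
    rw [hr', mulVec_sub, mulVec_mulVec]
  have horth : ((X * U) *ᵥ w - X *ᵥ bperp) ⬝ᵥ ((X * U) *ᵥ w) = 0 := by
    refine dotProduct_eq_zero_of_forall_vecNorm_le fun t => ?_
    have hdir : X *ᵥ (A *ᵥ (xtilde + t • y) - b) =
        (X * U) *ᵥ w - X *ᵥ bperp + t • ((X * U) *ᵥ w) := by
      have hshift : A *ᵥ (xtilde + t • y) - b = (A *ᵥ xtilde - b) + t • (U *ᵥ w) := by
        rw [mulVec_add, mulVec_smul, hA y, hy]
        abel
      rw [hshift, mulVec_add, hXp, mulVec_smul, mulVec_mulVec]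
    rw [← hdir, ← hXp]
    exact hxtilde _
  have hlower : w ⬝ᵥ w / 2 ≤ ((X * U) *ᵥ w) ⬝ᵥ ((X * U) *ᵥ w) := by
    have hsq := pow_le_pow_left₀ (mul_nonneg (by positivity) (vecNorm_nonneg w)) (hcond1 w) 2
    rw [mul_pow, div_pow, Real.sq_sqrt (by norm_num), vecNorm_sq, vecNorm_sq] at hsq
    linarith
  have hbound := dotProduct_self_le_of_residual_orthogonal hlower horth
  rw [vecNorm_sq] at hcond2
  refine (pow_le_pow_iff_left₀ (vecNorm_nonneg _) (mul_nonneg (by linarith [hε.1]) hZ0) two_ne_zero).mp ?_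
  rw [hp]
  nlinarith [sq_nonneg (ε * Z)]
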